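/- arXiv:2405.11763 — 3 statements merged into one kernel-verified Lean document; each statement's English description precedes it below -/
import Mathlib

section
/- Let k, μ ∈ ℂ with μ² = 2 + k² and 3 + k² + 2μ ≠ 0, and define u(x) = e^{−μx}(3 + k² + 2μ)^{−1}·(−sech²(x)) and v(x) = e^{−μx}(3 + k² + 2μ)^{−1}·(3 + k² + 2μ·tanh(x) − sech²(x)). Then for all x ∈ ℝ: −u''(x) + u(x) − 4·sech²(x)·u(x) − 2·sech²(x)·v(x) = (k²+1)·u(x) and v''(x) − v(x) + 2·sech²(x)·u(x) + 4·sech²(x)·v(x) = (k²+1)·v(x). -/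
open Polynomial in
/-- A polynomial in `tanh x` times `exp (-μ x)` has a derivative of the same form. -/
theorem hasDerivAt_exp_mul_eval_tanh (μ c : ℂ) (P : ℂ[X]) (x : ℝ) :
    HasDerivAt (fun y : ℝ => Complex.exp (-(μ * (y : ℂ))) * c * P.eval (Real.tanh y : ℂ))
      (Complex.exp (-(μ * (x : ℂ))) * c *
        (-C μ * P + derivative P * (1 - X ^ 2)).eval (Real.tanh x : ℂ)) x := by
  have hT : HasDerivAt Real.tanh (1 - Real.tanh x ^ 2) x := by
    have h := (Real.hasDerivAt_sinh x).div (Real.hasDerivAt_cosh x) (Real.cosh_pos x).ne'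
    have hfun : Real.tanh = Real.sinh / Real.cosh := by
      ext y
      exact Real.tanh_eq_sinh_div_cosh y
    rw [← hfun] at h
    refine h.congr_deriv ?_
    rw [Real.tanh_eq_sinh_div_cosh]
    field_simp [(Real.cosh_pos x).ne']
  have hE : HasDerivAt (fun y : ℝ => Complex.exp (-(μ * (y : ℂ))))
      (Complex.exp (-(μ * (x : ℂ))) * -(μ * 1)) x :=
    (((hasDerivAt_id x).ofReal_comp).const_mul μ).neg.cexp
  have hP := (P.hasDerivAt (Real.tanh x : ℂ)).comp x hT.ofReal_comp
  refine ((hE.mul_const c).mul hP).congr_deriv ?_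
  simp only [eval_add, eval_mul, eval_neg, eval_sub, eval_pow, eval_C, eval_X, eval_one,
    Function.comp_apply]
  push_cast
  ring

open Polynomial in
theorem deriv_exp_mul_eval_tanh (μ c : ℂ) (P : ℂ[X]) :
    deriv (fun y : ℝ => Complex.exp (-(μ * (y : ℂ))) * c * P.eval (Real.tanh y : ℂ)) =
      fun x : ℝ => Complex.exp (-(μ * (x : ℂ))) * c *
        (-C μ * P + derivative P * (1 - X ^ 2)).eval (Real.tanh x : ℂ) :=
  funext fun x => (hasDerivAt_exp_mul_eval_tanh μ c P x).deriv

theorem ofReal_cosh_inv_sq (x : ℝ) :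
    ((Real.cosh x : ℂ))⁻¹ ^ 2 = 1 - (Real.tanh x : ℂ) ^ 2 := by
  have h : (Real.cosh x)⁻¹ ^ 2 = 1 - Real.tanh x ^ 2 := by
    have hc := (Real.cosh_pos x).ne'
    rw [Real.tanh_eq_sinh_div_cosh]
    field_simp
    linarith [Real.cosh_sq_sub_sinh_sq x]
  exact_mod_cast congrArg Complex.ofReal h

open Complex in
/-- the explicit Jost solution `f₃(x,k)` at `p = 3` solves the
linearized system `H u⃗ = (k²+1) u⃗` at the cubic NLS ground state. -/
theorem stmt_8 (k μ : ℂ) (hμ : μ ^ 2 = 2 + k ^ 2) (hden : 3 + k ^ 2 + 2 * μ ≠ 0)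
    (u v : ℝ → ℂ)
    (hu : u = fun x : ℝ => Complex.exp (-(μ * (x : ℂ))) * (3 + k ^ 2 + 2 * μ)⁻¹ *
      (-(((Real.cosh x : ℂ))⁻¹ ^ 2)))
    (hv : v = fun x : ℝ => Complex.exp (-(μ * (x : ℂ))) * (3 + k ^ 2 + 2 * μ)⁻¹ *
      (3 + k ^ 2 + 2 * μ * (Real.tanh x : ℂ) - ((Real.cosh x : ℂ))⁻¹ ^ 2)) :
    ∀ x : ℝ,
      (-(deriv (deriv u) x) + u x
        - 4 * ((Real.cosh x : ℂ))⁻¹ ^ 2 * u x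
        - 2 * ((Real.cosh x : ℂ))⁻¹ ^ 2 * v x = (k ^ 2 + 1) * u x) ∧
      (deriv (deriv v) x - v x
        + 2 * ((Real.cosh x : ℂ))⁻¹ ^ 2 * u x
        + 4 * ((Real.cosh x : ℂ))⁻¹ ^ 2 * v x = (k ^ 2 + 1) * v x) := by
  have hu' : u = fun x : ℝ => Complex.exp (-(μ * (x : ℂ))) * (3 + k ^ 2 + 2 * μ)⁻¹ *
      (Polynomial.X ^ 2 - 1 : Polynomial ℂ).eval (Real.tanh x : ℂ) := by
    rw [hu]
    funext x
    rw [ofReal_cosh_inv_sq]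
    simp
  have hv' : v = fun x : ℝ => Complex.exp (-(μ * (x : ℂ))) * (3 + k ^ 2 + 2 * μ)⁻¹ *
      (Polynomial.C (2 + k ^ 2) + Polynomial.C (2 * μ) * Polynomial.X + Polynomial.X ^ 2).eval
        (Real.tanh x : ℂ) := by
    rw [hv]
    funext x
    rw [ofReal_cosh_inv_sq]
    simp only [Polynomial.eval_add, Polynomial.eval_mul, Polynomial.eval_pow, Polynomial.eval_C,
      Polynomial.eval_X]
    ring
  have hk : k ^ 2 = μ ^ 2 - 2 := by linear_combination -hμ
  intro x
  rw [hu', hv', ofReal_cosh_inv_sq]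
  simp only [deriv_exp_mul_eval_tanh]
  generalize (3 + k ^ 2 + 2 * μ)⁻¹ = c
  generalize (Real.tanh x : ℂ) = T
  generalize Complex.exp (-(μ * (x : ℂ))) = E
  simp only [Polynomial.derivative_add, Polynomial.derivative_sub, Polynomial.derivative_mul,
    Polynomial.derivative_neg, Polynomial.derivative_X_pow, Polynomial.derivative_C,
    Polynomial.derivative_X, Polynomial.derivative_one, Polynomial.derivative_zero,
    Polynomial.eval_add, Polynomial.eval_sub,
    Polynomial.eval_mul, Polynomial.eval_neg, Polynomial.eval_pow, Polynomial.eval_C,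
    Polynomial.eval_X, Polynomial.eval_one, Polynomial.eval_zero, hk]
  push_cast
  constructor <;> ring
end

section
/- Let p > 1 and φ = φ_p. Define, for sufficiently differentiable g : ℝ → ℂ: S*g = −(φ·g)'/φ; L₊g = −g'' + g − p·φ^{p−1}·g; L₋g = −g'' + g − φ^{p−1}·g; L₂g = −g'' + g − ((3−p)/(p+1))·φ^{p−1}·g; L₃g = −g'' + g − ((3−p)(2−p)/(p+1))·φ^{p−1}·g. Then for every six-times continuously differentiable f : ℝ → ℂ and every x ∈ ℝ, the intertwining identity L₋(L₊((S*)²f))(x) = (S*)²(L₃(L₂f))(x) holds. -/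
/-- The ground state `φ_p` of the pure power NLS on the line. -/
noncomputable def groundState (p x : ℝ) : ℝ :=
  ((p + 1) / 2) ^ (1 / (p - 1)) * (1 / Real.cosh ((p - 1) * x / 2)) ^ (2 / (p - 1))

/-- The Darboux-type first order factor `S* g = −(φ g)'/φ`. -/
noncomputable def Sstar (p : ℝ) (g : ℝ → ℂ) : ℝ → ℂ :=
  fun x => -(deriv (fun y : ℝ => ((groundState p y : ℝ) : ℂ) * g y) x) /
    ((groundState p x : ℝ) : ℂ)

/-- `L₊ g = −g'' + g − p φ^{p−1} g`. -/
noncomputable def Lplus (p : ℝ) (g : ℝ → ℂ) : ℝ → ℂ :=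
  fun x => -(deriv (deriv g) x) + g x - ((p * groundState p x ^ (p - 1) : ℝ) : ℂ) * g x

/-- `L₋ g = −g'' + g − φ^{p−1} g`. -/
noncomputable def Lminus (p : ℝ) (g : ℝ → ℂ) : ℝ → ℂ :=
  fun x => -(deriv (deriv g) x) + g x - ((groundState p x ^ (p - 1) : ℝ) : ℂ) * g x

/-- `L₂ g = −g'' + g − ((3−p)/(p+1)) φ^{p−1} g`. -/
noncomputable def Ltwo (p : ℝ) (g : ℝ → ℂ) : ℝ → ℂ :=
  fun x => -(deriv (deriv g) x) + g x
    - (((3 - p) / (p + 1) * groundState p x ^ (p - 1) : ℝ) : ℂ) * g x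

/-- `L₃ g = −g'' + g − ((3−p)(2−p)/(p+1)) φ^{p−1} g`. -/
noncomputable def Lthree (p : ℝ) (g : ℝ → ℂ) : ℝ → ℂ :=
  fun x => -(deriv (deriv g) x) + g x
    - (((3 - p) * (2 - p) / (p + 1) * groundState p x ^ (p - 1) : ℝ) : ℂ) * g x

/-- `-φ_p'/φ_p`, as a complex valued function. -/
noncomputable def groundSlope (p : ℝ) : ℝ → ℂ :=
  fun x => ((Real.sinh ((p - 1) * x / 2) / Real.cosh ((p - 1) * x / 2) : ℝ) : ℂ)

/-- The Schrödinger operator `g ↦ -g'' + g - c (1 - T²) g`, where `T` is `groundSlope p`. -/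
noncomputable def schrodinger (p : ℝ) (c : ℂ) (g : ℝ → ℂ) : ℝ → ℂ :=
  fun x => -(deriv (deriv g) x) + g x - c * ((1 - groundSlope p x ^ 2) * g x)

lemma groundState_pos {p : ℝ} (hp : 1 < p) (x : ℝ) : 0 < groundState p x := by
  unfold groundState
  have := Real.cosh_pos ((p - 1) * x / 2)
  have : 0 < p + 1 := by linarith
  positivity

lemma hasDerivAt_groundState {p : ℝ} (hp : 1 < p) (x : ℝ) :
    HasDerivAt (groundState p)
      (-(Real.sinh ((p - 1) * x / 2) / Real.cosh ((p - 1) * x / 2)) * groundState p x) x := by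
  have hc := Real.cosh_pos ((p - 1) * x / 2)
  have hp1 : p - 1 ≠ 0 := by linarith
  have hlin : HasDerivAt (fun y : ℝ => (p - 1) * y / 2) ((p - 1) / 2) x := by
    simpa using ((hasDerivAt_id x).const_mul (p - 1)).div_const 2
  have hinv : HasDerivAt (fun y : ℝ => 1 / Real.cosh ((p - 1) * y / 2))
      (-(Real.sinh ((p - 1) * x / 2) * ((p - 1) / 2)) / Real.cosh ((p - 1) * x / 2) ^ 2) x := by
    simpa only [one_div] using! hlin.cosh.inv hc.ne'
  have hpow := (hinv.rpow_const (p := 2 / (p - 1)) (Or.inl (by positivity))).const_mul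
    (((p + 1) / 2) ^ (1 / (p - 1)))
  refine hpow.congr_deriv ?_
  rw [Real.rpow_sub_one (by positivity)]
  unfold groundState
  field_simp

lemma groundState_rpow {p : ℝ} (hp : 1 < p) (x : ℝ) :
    groundState p x ^ (p - 1) = (p + 1) / 2 *
      (1 - (Real.sinh ((p - 1) * x / 2) / Real.cosh ((p - 1) * x / 2)) ^ 2) := by
  have hc := Real.cosh_pos ((p - 1) * x / 2)
  have hp1 : p - 1 ≠ 0 := by linarith
  have hp2 : 0 < p + 1 := by linarith
  unfold groundState
  rw [Real.mul_rpow (by positivity) (by positivity), ← Real.rpow_mul (by positivity),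
    ← Real.rpow_mul (by positivity), one_div_mul_cancel hp1, div_mul_cancel₀ _ hp1,
    Real.rpow_one, Real.rpow_two, div_pow, div_pow, Real.sinh_sq]
  field_simp
  ring

lemma hasDerivAt_groundSlope (p x : ℝ) :
    HasDerivAt (groundSlope p) ((p - 1) / 2 * (1 - groundSlope p x ^ 2)) x := by
  have hc := Real.cosh_pos ((p - 1) * x / 2)
  have hlin : HasDerivAt (fun y : ℝ => (p - 1) * y / 2) ((p - 1) / 2) x := by
    simpa using ((hasDerivAt_id x).const_mul (p - 1)).div_const 2
  refine ((hlin.sinh.div hlin.cosh hc.ne').ofReal_comp).congr_deriv ?_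
  unfold groundSlope
  norm_cast
  rw [div_pow]
  field_simp

lemma contDiff_groundSlope (p : ℝ) {n : ℕ∞} : ContDiff ℝ n (groundSlope p) := by
  refine Complex.ofRealCLM.contDiff.comp (ContDiff.div ?_ ?_ fun x => (Real.cosh_pos _).ne')
  · exact Real.contDiff_sinh.comp (by fun_prop)
  · exact Real.contDiff_cosh.comp (by fun_prop)

lemma Sstar_eq {p : ℝ} (hp : 1 < p) {g : ℝ → ℂ} (hg : Differentiable ℝ g) :
    Sstar p g = fun x => groundSlope p x * g x - deriv g x := by
  funext x
  have h0 : ((groundState p x : ℝ) : ℂ) ≠ 0 := by exact_mod_cast (groundState_pos hp x).ne'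
  have h := ((hasDerivAt_groundState hp x).ofReal_comp.mul (hg x).hasDerivAt).deriv
  unfold Sstar groundSlope
  rw [show deriv (fun y : ℝ => ((groundState p y : ℝ) : ℂ) * g y) x = _ from h]
  push_cast
  field_simp
  ring

lemma contDiff_deriv {g : ℝ → ℂ} {n : ℕ} (hg : ContDiff ℝ (n + 1 : ℕ) g) :
    ContDiff ℝ n (deriv g) := by
  simpa using ContDiff.iterate_deriv' n 1 hg

lemma contDiff_Sstar {p : ℝ} (hp : 1 < p) {g : ℝ → ℂ} {n : ℕ} (hg : ContDiff ℝ (n + 1 : ℕ) g) :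
    ContDiff ℝ n (Sstar p g) := by
  rw [Sstar_eq hp (hg.differentiable (by simp))]
  exact ((contDiff_groundSlope p (n := n)).mul (hg.of_le (by norm_cast; omega))).sub
    (contDiff_deriv hg)

lemma contDiff_schrodinger (p : ℝ) (c : ℂ) {g : ℝ → ℂ} {n : ℕ} (hg : ContDiff ℝ (n + 2 : ℕ) g) :
    ContDiff ℝ n (schrodinger p c g) := by
  have hg' : ContDiff ℝ n g := hg.of_le (by norm_cast; omega)
  have hT := contDiff_groundSlope p (n := n)
  exact ((contDiff_deriv (contDiff_deriv hg)).neg.add hg').sub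
    (contDiff_const.mul ((contDiff_const.sub (hT.pow 2)).mul hg'))

lemma iteratedDeriv_Sstar {p : ℝ} (hp : 1 < p) {g : ℝ → ℂ} {n : ℕ}
    (hg : ContDiff ℝ (n + 1 : ℕ) g) (x : ℝ) :
    iteratedDeriv n (Sstar p g) x =
      ∑ i ∈ Finset.range (n + 1), n.choose i * iteratedDeriv i (groundSlope p) x *
        iteratedDeriv (n - i) g x - iteratedDeriv (n + 1) g x := by
  have hg' : ContDiff ℝ n g := hg.of_le (by norm_cast; omega)
  have hT := contDiff_groundSlope p (n := n)
  rw [Sstar_eq hp (hg.differentiable (by simp)),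
    iteratedDeriv_fun_sub (hT.mul hg').contDiffAt (contDiff_deriv hg).contDiffAt,
    iteratedDeriv_fun_mul hT.contDiffAt hg'.contDiffAt, iteratedDeriv_succ']

lemma iteratedDeriv_schrodinger (p : ℝ) (c : ℂ) {g : ℝ → ℂ} {n : ℕ}
    (hg : ContDiff ℝ (n + 2 : ℕ) g) (x : ℝ) :
    iteratedDeriv n (schrodinger p c g) x =
      -iteratedDeriv (n + 2) g x + iteratedDeriv n g x -
        c * ∑ i ∈ Finset.range (n + 1),
          n.choose i * iteratedDeriv i (fun y => 1 - groundSlope p y ^ 2) x *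
            iteratedDeriv (n - i) g x := by
  have hg' : ContDiff ℝ n g := hg.of_le (by norm_cast; omega)
  have hU : ContDiff ℝ n (fun y => 1 - groundSlope p y ^ 2) :=
    contDiff_const.sub ((contDiff_groundSlope p (n := n)).pow 2)
  have hg2 := contDiff_deriv (contDiff_deriv hg)
  unfold schrodinger
  rw [iteratedDeriv_fun_sub (hg2.neg.add hg').contDiffAt
      (contDiff_const.mul (hU.mul hg')).contDiffAt,
    iteratedDeriv_fun_add hg2.neg.contDiffAt hg'.contDiffAt, iteratedDeriv_fun_neg,
    iteratedDeriv_const_mul_field, iteratedDeriv_fun_mul hU.contDiffAt hg'.contDiffAt,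
    iteratedDeriv_succ', iteratedDeriv_succ']

lemma Lminus_eq {p : ℝ} (hp : 1 < p) (g : ℝ → ℂ) :
    Lminus p g = schrodinger p ((p + 1) / 2) g := by
  funext x
  simp only [Lminus, schrodinger, groundState_rpow hp, groundSlope]
  push_cast
  ring

lemma Lplus_eq {p : ℝ} (hp : 1 < p) (g : ℝ → ℂ) :
    Lplus p g = schrodinger p (p * (p + 1) / 2) g := by
  funext x
  simp only [Lplus, schrodinger, groundState_rpow hp, groundSlope]
  push_cast
  ring

lemma Ltwo_eq {p : ℝ} (hp : 1 < p) (g : ℝ → ℂ) :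
    Ltwo p g = schrodinger p ((3 - p) / 2) g := by
  have h : (p : ℂ) + 1 ≠ 0 := by exact_mod_cast (by linarith : p + 1 ≠ 0)
  funext x
  simp only [Ltwo, schrodinger, groundState_rpow hp, groundSlope]
  push_cast
  field_simp

lemma Lthree_eq {p : ℝ} (hp : 1 < p) (g : ℝ → ℂ) :
    Lthree p g = schrodinger p ((3 - p) * (2 - p) / 2) g := by
  have h : (p : ℂ) + 1 ≠ 0 := by exact_mod_cast (by linarith : p + 1 ≠ 0)
  funext x
  simp only [Lthree, schrodinger, groundState_rpow hp, groundSlope]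
  push_cast
  field_simp

/-- Derivative of a polynomial in `groundSlope p`. -/
lemma deriv_eval_groundSlope (p : ℝ) (P : Polynomial ℂ) :
    deriv (fun x => P.eval (groundSlope p x)) = fun x =>
      (Polynomial.C (((p : ℂ) - 1) / 2) * (1 - Polynomial.X ^ 2) * P.derivative).eval
        (groundSlope p x) := by
  funext x
  refine ((P.hasDerivAt (groundSlope p x)).comp x (hasDerivAt_groundSlope p x)).deriv.trans ?_
  simp
  ring

lemma iteratedDeriv_eval_groundSlope (p : ℝ) (n : ℕ) (P : Polynomial ℂ) :
    iteratedDeriv n (fun x => P.eval (groundSlope p x)) = fun x =>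
      ((fun Q => Polynomial.C (((p : ℂ) - 1) / 2) * (1 - Polynomial.X ^ 2) *
        Polynomial.derivative Q)^[n] P).eval (groundSlope p x) := by
  induction n generalizing P with
  | zero => simp
  | succ n ih => rw [iteratedDeriv_succ', deriv_eval_groundSlope, ih, Function.iterate_succ_apply]

lemma iteratedDeriv_groundSlope (p : ℝ) (n : ℕ) (x : ℝ) :
    iteratedDeriv n (groundSlope p) x =
      ((fun Q => Polynomial.C (((p : ℂ) - 1) / 2) * (1 - Polynomial.X ^ 2) *
        Polynomial.derivative Q)^[n] Polynomial.X).eval (groundSlope p x) := by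
  have h := congrFun (iteratedDeriv_eval_groundSlope p n Polynomial.X) x
  simpa only [Polynomial.eval_X] using h

lemma iteratedDeriv_one_sub_groundSlope_sq (p : ℝ) (n : ℕ) (x : ℝ) :
    iteratedDeriv n (fun y => 1 - groundSlope p y ^ 2) x =
      ((fun Q => Polynomial.C (((p : ℂ) - 1) / 2) * (1 - Polynomial.X ^ 2) *
        Polynomial.derivative Q)^[n] (1 - Polynomial.X ^ 2)).eval (groundSlope p x) := by
  have h := congrFun (iteratedDeriv_eval_groundSlope p n (1 - Polynomial.X ^ 2)) x
  simpa only [Polynomial.eval_sub, Polynomial.eval_one, Polynomial.eval_pow, Polynomial.eval_X]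
    using h

/-- the intertwining identity `L₋ L₊ (S*)² = (S*)² L₃ L₂`. -/
theorem stmt_12 (p : ℝ) (hp : 1 < p) (f : ℝ → ℂ) (hf : ContDiff ℝ 6 f) :
    ∀ x : ℝ,
      Lminus p (Lplus p (Sstar p (Sstar p f))) x
        = Sstar p (Sstar p (Lthree p (Ltwo p f))) x := by
  intro x
  have hle {n : ℕ} (h : n ≤ 6) : ContDiff ℝ n f := hf.of_le (by exact_mod_cast h)
  have hS {n : ℕ} (h : n ≤ 5) : ContDiff ℝ n (Sstar p f) := contDiff_Sstar hp (hle (by omega))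
  have hSS {n : ℕ} (h : n ≤ 4) : ContDiff ℝ n (Sstar p (Sstar p f)) :=
    contDiff_Sstar hp (hS (by omega))
  have hLSS (c : ℂ) {n : ℕ} (h : n ≤ 2) : ContDiff ℝ n (schrodinger p c (Sstar p (Sstar p f))) :=
    contDiff_schrodinger p c (hSS (by omega))
  have hL (c : ℂ) {n : ℕ} (h : n ≤ 4) : ContDiff ℝ n (schrodinger p c f) :=
    contDiff_schrodinger p c (hle (by omega))
  have hLL (c d : ℂ) {n : ℕ} (h : n ≤ 2) : ContDiff ℝ n (schrodinger p d (schrodinger p c f)) :=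
    contDiff_schrodinger p d (hL c (by omega))
  have hSLL (c d : ℂ) {n : ℕ} (h : n ≤ 1) :
      ContDiff ℝ n (Sstar p (schrodinger p d (schrodinger p c f))) :=
    contDiff_Sstar hp (hLL c d (by omega))
  have eS {n : ℕ} (h : n ≤ 5) := iteratedDeriv_Sstar hp (hle (n := n + 1) (by omega)) x
  have eSS {n : ℕ} (h : n ≤ 4) := iteratedDeriv_Sstar hp (hS (n := n + 1) (by omega)) x
  have eLSS (c : ℂ) {n : ℕ} (h : n ≤ 2) :=
    iteratedDeriv_schrodinger p c (hSS (n := n + 2) (by omega)) x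
  have eLLSS (c d : ℂ) := iteratedDeriv_schrodinger p d (hLSS c (n := 0 + 2) le_rfl) x
  have eL (c : ℂ) {n : ℕ} (h : n ≤ 4) :=
    iteratedDeriv_schrodinger p c (hle (n := n + 2) (by omega)) x
  have eLL (c d : ℂ) {n : ℕ} (h : n ≤ 2) :=
    iteratedDeriv_schrodinger p d (hL c (n := n + 2) (by omega)) x
  have eSLL (c d : ℂ) {n : ℕ} (h : n ≤ 1) :=
    iteratedDeriv_Sstar hp (hLL c d (n := n + 1) (by omega)) x
  have eSSLL (c d : ℂ) := iteratedDeriv_Sstar hp (hSLL c d (n := 0 + 1) le_rfl) x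
  simp only [Lminus_eq hp, Lplus_eq hp, Ltwo_eq hp, Lthree_eq hp]
  rw [show schrodinger p _ (schrodinger p _ (Sstar p (Sstar p f))) x = _ from
      (congrFun iteratedDeriv_zero x).symm.trans (eLLSS _ _),
    show Sstar p (Sstar p (schrodinger p _ (schrodinger p _ f))) x = _ from
      (congrFun iteratedDeriv_zero x).symm.trans (eSSLL _ _)]
  simp (discharger := norm_num) only [eSLL, eLL, eL, eLSS, eSS, eS, Finset.sum_range_succ,
    Finset.sum_range_zero, iteratedDeriv_groundSlope, iteratedDeriv_one_sub_groundSlope_sq,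
    Nat.reduceAdd, Nat.reduceSub, zero_add]
  simp [Nat.choose, Function.iterate_succ_apply, Polynomial.derivative_pow]
  ring
end

section
/- The function g(x) = −11·(x·tanh(x) − log(e^x + e^{−x}))·cosh(x) + sech(x) + 21·sech(x)³ − 20·sech(x)⁵ satisfies: x ↦ cos(x)·g(x) is integrable on ℝ and ∫_ℝ cos(x)·g(x) dx > 0. (Consequently the imaginary part of the threshold correction ζ̃₃ equals b·cos(x) with b = (√2/60)·∫_ℝ cos(x)·g(x) dx > 0.) -/
open MeasureTheory

open Filter Topology

/-- `log (eˣ + e⁻ˣ) - x tanh x`, which decays like `(2|x| + 1) e^{-2|x|}`. -/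
noncomputable def logTwoCoshDefect (x : ℝ) : ℝ :=
  Real.log (Real.exp x + Real.exp (-x)) - x * Real.tanh x

lemma linear_mul_one_add_sq_le_exp {y : ℝ} (hy : 0 ≤ y) : (2 * y + 1) * (1 + y ^ 2) ≤ 12 * Real.exp y := by
  have h := Real.sum_le_exp_of_nonneg hy 4
  simp only [Finset.sum_range_succ, Finset.sum_range_zero] at h
  norm_num [Nat.factorial] at h
  nlinarith [sq_nonneg y]

lemma linear_mul_exp_neg_le {y : ℝ} (hy : 0 ≤ y) :
    (2 * y + 1) * Real.exp (-y) ≤ 12 * (1 + y ^ 2)⁻¹ := by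
  rw [Real.exp_neg, ← div_eq_mul_inv, ← div_eq_mul_inv,
    div_le_div_iff₀ (Real.exp_pos y) (by positivity)]
  exact linear_mul_one_add_sq_le_exp hy

lemma inv_cosh_pos (x : ℝ) : 0 < (Real.cosh x)⁻¹ := inv_pos.2 (Real.cosh_pos x)

lemma inv_cosh_le_one (x : ℝ) : (Real.cosh x)⁻¹ ≤ 1 := inv_le_one_of_one_le₀ (Real.one_le_cosh x)

lemma inv_cosh_le_exp_neg_abs (x : ℝ) : (Real.cosh x)⁻¹ ≤ 2 * Real.exp (-|x|) := by
  rw [← Real.cosh_abs, Real.exp_neg, ← div_eq_mul_inv, inv_eq_one_div,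
    div_le_div_iff₀ (Real.cosh_pos _) (Real.exp_pos _), Real.cosh_eq]
  linarith [Real.exp_pos (-|x|)]

lemma linear_mul_inv_cosh_le (x : ℝ) :
    (2 * |x| + 1) * (Real.cosh x)⁻¹ ≤ 24 * (1 + x ^ 2)⁻¹ := by
  have h := linear_mul_exp_neg_le (abs_nonneg x)
  rw [sq_abs] at h
  calc (2 * |x| + 1) * (Real.cosh x)⁻¹
      ≤ (2 * |x| + 1) * (2 * Real.exp (-|x|)) := by
        gcongr
        exact inv_cosh_le_exp_neg_abs x
    _ ≤ _ := by linarith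

lemma inv_cosh_le (x : ℝ) : (Real.cosh x)⁻¹ ≤ 24 * (1 + x ^ 2)⁻¹ := by
  nlinarith [linear_mul_inv_cosh_le x, mul_nonneg (abs_nonneg x) (inv_cosh_pos x).le]

lemma abs_sinh_mul_inv_cosh_le (x : ℝ) : |Real.sinh x * (Real.cosh x)⁻¹| ≤ 1 := by
  rw [← div_eq_mul_inv, ← Real.tanh_eq_sinh_div_cosh]
  exact (Real.abs_tanh_lt_one x).le

lemma logTwoCoshDefect_abs (x : ℝ) : logTwoCoshDefect |x| = logTwoCoshDefect x := by
  rcases abs_choice x with h | h <;> rw [h]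
  simp [logTwoCoshDefect, add_comm]

lemma abs_logTwoCoshDefect_le (x : ℝ) :
    |logTwoCoshDefect x| ≤ (2 * |x| + 1) * Real.exp (-|x|) ^ 2 := by
  rw [← logTwoCoshDefect_abs]
  have hy := abs_nonneg x
  generalize |x| = y at hy ⊢
  have hc := Real.cosh_pos y
  have hE : Real.exp y * Real.exp (-y) = 1 := by rw [← Real.exp_add]; simp
  have hpos := Real.exp_pos y
  have hneg := Real.exp_pos (-y)
  have hlog : Real.log (Real.exp y + Real.exp (-y)) = y + Real.log (1 + Real.exp (-y) ^ 2) := by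
    rw [show Real.exp y + Real.exp (-y) = Real.exp y * (1 + Real.exp (-y) ^ 2) by
      linear_combination (-Real.exp (-y)) * hE, Real.log_mul hpos.ne' (by positivity),
      Real.log_exp]
  have hlog_nonneg : 0 ≤ Real.log (1 + Real.exp (-y) ^ 2) := Real.log_nonneg (by nlinarith)
  have hlog_le : Real.log (1 + Real.exp (-y) ^ 2) ≤ Real.exp (-y) ^ 2 := by
    linarith [Real.log_le_sub_one_of_pos (show 0 < 1 + Real.exp (-y) ^ 2 by positivity)]
  have htanh : 1 - Real.tanh y = Real.exp (-y) / Real.cosh y := by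
    rw [Real.tanh_eq_sinh_div_cosh, eq_div_iff hc.ne', sub_mul, div_mul_cancel₀ _ hc.ne',
      Real.cosh_eq, Real.sinh_eq]
    ring
  have htanh_le : 1 - Real.tanh y ≤ 2 * Real.exp (-y) ^ 2 := by
    rw [htanh, div_le_iff₀ hc, Real.cosh_eq]
    nlinarith [pow_pos hneg 3]
  have htanh_nonneg : 0 ≤ 1 - Real.tanh y := by rw [htanh]; positivity
  have heq : logTwoCoshDefect y = y * (1 - Real.tanh y) + Real.log (1 + Real.exp (-y) ^ 2) := by
    rw [logTwoCoshDefect, hlog]; ring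
  rw [heq, abs_of_nonneg (by positivity)]
  nlinarith [mul_le_mul_of_nonneg_left htanh_le hy]

lemma abs_logTwoCoshDefect_mul_cosh_le (x : ℝ) :
    |logTwoCoshDefect x| * Real.cosh x ≤ 12 * (1 + x ^ 2)⁻¹ := by
  have h := linear_mul_exp_neg_le (abs_nonneg x)
  rw [sq_abs] at h
  have hE : Real.exp |x| * Real.exp (-|x|) = 1 := by rw [← Real.exp_add]; simp
  have hcosh : Real.cosh x ≤ Real.exp |x| := by
    rw [← Real.cosh_abs, Real.cosh_eq]
    linarith [Real.exp_le_exp.2 (show -|x| ≤ |x| by linarith [abs_nonneg x])]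
  calc |logTwoCoshDefect x| * Real.cosh x
      ≤ (2 * |x| + 1) * Real.exp (-|x|) ^ 2 * Real.exp |x| := by
        gcongr
        · exact abs_logTwoCoshDefect_le x
    _ = (2 * |x| + 1) * Real.exp (-|x|) := by
        linear_combination (2 * |x| + 1) * Real.exp (-|x|) * hE
    _ ≤ _ := h

lemma hasDerivAt_inv_cosh (x : ℝ) :
    HasDerivAt (fun x => (Real.cosh x)⁻¹) (-(Real.sinh x * (Real.cosh x)⁻¹ ^ 2)) x := by
  refine ((Real.hasDerivAt_cosh x).fun_inv (Real.cosh_pos x).ne').congr_deriv ?_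
  rw [inv_pow, div_eq_mul_inv, neg_mul]

lemma hasDerivAt_logTwoCoshDefect (x : ℝ) :
    HasDerivAt logTwoCoshDefect (-(x * (Real.cosh x)⁻¹ ^ 2)) x := by
  have hc := (Real.cosh_pos x).ne'
  have hfun : logTwoCoshDefect =
      fun x => Real.log (2 * Real.cosh x) - x * (Real.sinh x * (Real.cosh x)⁻¹) := by
    funext y
    rw [logTwoCoshDefect, Real.tanh_eq_sinh_div_cosh, Real.cosh_eq y, div_eq_mul_inv]
    ring_nf
  rw [hfun]
  have h := (((Real.hasDerivAt_cosh x).const_mul 2).log (by positivity)).fun_sub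
    ((hasDerivAt_id' x).fun_mul ((Real.hasDerivAt_sinh x).fun_mul (hasDerivAt_inv_cosh x)))
  refine h.congr_deriv ?_
  field_simp
  linear_combination (-x) * Real.cosh_sq x

lemma integrable_of_abs_le_inv_one_add_sq {f : ℝ → ℝ} (C : ℝ) (hf : Continuous f)
    (h : ∀ x, |f x| ≤ C * (1 + x ^ 2)⁻¹) : Integrable f :=
  (integrable_inv_one_add_sq.const_mul C).mono' hf.aestronglyMeasurable (.of_forall h)

lemma tendsto_zero_of_abs_le_inv_one_add_sq {f : ℝ → ℝ} {l : Filter ℝ} (C : ℝ)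
    (hl : Tendsto (fun x : ℝ => x ^ 2) l atTop)
    (h : ∀ x, |f x| ≤ C * (1 + x ^ 2)⁻¹) : Tendsto f l (𝓝 0) := by
  refine squeeze_zero_norm h ?_
  simpa using (tendsto_inv_atTop_zero.comp (tendsto_atTop_add_const_left l 1 hl)).const_mul C

lemma continuous_inv_cosh : Continuous fun x : ℝ => (Real.cosh x)⁻¹ :=
  Real.continuous_cosh.inv₀ fun x => (Real.cosh_pos x).ne'

lemma continuous_logTwoCoshDefect : Continuous logTwoCoshDefect :=
  continuous_iff_continuousAt.2 fun x => (hasDerivAt_logTwoCoshDefect x).continuousAt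

lemma integrable_mul_inv_cosh {b : ℝ → ℝ} (hb : Continuous b) (C : ℝ) (h : ∀ x, |b x| ≤ C) :
    Integrable fun x : ℝ => b x * (Real.cosh x)⁻¹ := by
  have hs : Integrable fun x : ℝ => (Real.cosh x)⁻¹ :=
    integrable_of_abs_le_inv_one_add_sq 24 continuous_inv_cosh fun x => by
      rw [abs_of_pos (inv_cosh_pos x)]; exact inv_cosh_le x
  exact hs.bdd_mul hb.aestronglyMeasurable (.of_forall h)

lemma integrable_cos_mul_cosh_mul_logTwoCoshDefect :
    Integrable fun x : ℝ => Real.cos x * (logTwoCoshDefect x * Real.cosh x) := by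
  refine integrable_of_abs_le_inv_one_add_sq 12 (by
    have := continuous_logTwoCoshDefect
    fun_prop) fun x => ?_
  rw [abs_mul, abs_mul, abs_of_pos (Real.cosh_pos x)]
  have h := abs_logTwoCoshDefect_mul_cosh_le x
  have hnn := mul_nonneg (abs_nonneg (logTwoCoshDefect x)) (Real.cosh_pos x).le
  nlinarith [Real.abs_cos_le_one x]

lemma abs_cos_mul_inv_cosh_pow_le (n : ℕ) (x : ℝ) : |Real.cos x * (Real.cosh x)⁻¹ ^ n| ≤ 1 := by
  rw [abs_mul, abs_pow, abs_of_pos (inv_cosh_pos x)]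
  exact mul_le_one₀ (Real.abs_cos_le_one x) (pow_nonneg (inv_cosh_pos x).le n)
    (pow_le_one₀ (inv_cosh_pos x).le (inv_cosh_le_one x))

lemma integrable_cos_mul_inv_cosh_pow {n : ℕ} (hn : n ≠ 0) :
    Integrable fun x : ℝ => Real.cos x * (Real.cosh x)⁻¹ ^ n := by
  obtain ⟨n, rfl⟩ := Nat.exists_eq_add_one_of_ne_zero hn
  have := continuous_inv_cosh
  refine (integrable_mul_inv_cosh (b := fun x => Real.cos x * (Real.cosh x)⁻¹ ^ n)
    (by fun_prop) 1 (abs_cos_mul_inv_cosh_pow_le n)).congr (.of_forall fun x => ?_)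
  simp only
  ring

lemma integrable_inv_cosh_pow {n : ℕ} (hn : n ≠ 0) :
    Integrable fun x : ℝ => (Real.cosh x)⁻¹ ^ n := by
  obtain ⟨n, rfl⟩ := Nat.exists_eq_add_one_of_ne_zero hn
  have := continuous_inv_cosh
  refine (integrable_mul_inv_cosh (b := fun x => (Real.cosh x)⁻¹ ^ n)
    (by fun_prop) 1 fun x => ?_).congr (.of_forall fun x => (pow_succ _ _).symm)
  rw [abs_pow, abs_of_pos (inv_cosh_pos x)]
  exact pow_le_one₀ (inv_cosh_pos x).le (inv_cosh_le_one x)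

lemma integral_eq_zero_of_hasDerivAt_of_abs_le {F F' : ℝ → ℝ} (C : ℝ)
    (hF : ∀ x, HasDerivAt F (F' x) x) (hF' : Integrable F')
    (h : ∀ x, |F x| ≤ C * (1 + x ^ 2)⁻¹) : ∫ x, F' x = 0 := by
  simpa using integral_of_hasDerivAt_of_tendsto hF hF'
    (tendsto_zero_of_abs_le_inv_one_add_sq C
      ((tendsto_pow_atTop two_ne_zero).comp tendsto_neg_atBot_atTop |>.congr fun x => by simp) h)
    (tendsto_zero_of_abs_le_inv_one_add_sq C (tendsto_pow_atTop two_ne_zero) h)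

lemma integral_cos_mul_cosh_mul_logTwoCoshDefect :
    ∫ x : ℝ, Real.cos x * (logTwoCoshDefect x * Real.cosh x) =
      (1 / 2) * ∫ x : ℝ, Real.cos x * (Real.cosh x)⁻¹ ^ 1 := by
  have hint := integrable_cos_mul_cosh_mul_logTwoCoshDefect
  have hint' := (integrable_cos_mul_inv_cosh_pow one_ne_zero).const_mul (1 / 2)
  rw [← sub_eq_zero, ← integral_const_mul, ← integral_sub hint hint']
  refine integral_eq_zero_of_hasDerivAt_of_abs_le (C := 36) (F := fun x =>
    (Real.sin x * Real.cosh x + Real.cos x * Real.sinh x) / 2 * logTwoCoshDefect x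
      - x * Real.cos x * (Real.cosh x)⁻¹ / 2) (fun x => ?_) (hint.sub hint') fun x => ?_
  · have hc := (Real.cosh_pos x).ne'
    have h := (((((Real.hasDerivAt_sin x).fun_mul (Real.hasDerivAt_cosh x)).fun_add
      ((Real.hasDerivAt_cos x).fun_mul (Real.hasDerivAt_sinh x))).div_const 2).fun_mul
      (hasDerivAt_logTwoCoshDefect x)).fun_sub
      ((((hasDerivAt_id' x).fun_mul (Real.hasDerivAt_cos x)).fun_mul (hasDerivAt_inv_cosh x)).div_const 2)
    refine h.congr_deriv ?_
    field_simp
    ring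
  · have hP : |(Real.sin x * Real.cosh x + Real.cos x * Real.sinh x) / 2| ≤ Real.cosh x := by
      have hs : |Real.sinh x| ≤ Real.cosh x := by
        rw [← abs_of_pos (Real.cosh_pos x)]
        exact sq_le_sq.1 (by linarith [Real.cosh_sq x])
      have h1 : |Real.sin x * Real.cosh x| ≤ 1 * Real.cosh x := by
        rw [abs_mul, abs_of_pos (Real.cosh_pos x)]
        exact mul_le_mul_of_nonneg_right (Real.abs_sin_le_one x) (Real.cosh_pos x).le
      have h2 : |Real.cos x * Real.sinh x| ≤ 1 * Real.cosh x := by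
        rw [abs_mul]
        exact mul_le_mul (Real.abs_cos_le_one x) hs (abs_nonneg _) zero_le_one
      rw [abs_div, abs_two]
      linarith [abs_add_le (Real.sin x * Real.cosh x) (Real.cos x * Real.sinh x)]
    have h1 : |(Real.sin x * Real.cosh x + Real.cos x * Real.sinh x) / 2 * logTwoCoshDefect x|
        ≤ |logTwoCoshDefect x| * Real.cosh x := by
      rw [abs_mul, mul_comm]
      exact mul_le_mul_of_nonneg_left hP (abs_nonneg _)
    have h2 : |x * Real.cos x * (Real.cosh x)⁻¹ / 2| ≤ |x| * (Real.cosh x)⁻¹ := by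
      rw [abs_div, abs_mul, abs_mul, abs_of_pos (inv_cosh_pos x), abs_two]
      have hx := mul_nonneg (abs_nonneg x) (inv_cosh_pos x).le
      nlinarith [Real.abs_cos_le_one x]
    have h3 := linear_mul_inv_cosh_le x
    have h4 := abs_logTwoCoshDefect_mul_cosh_le x
    have h5 := mul_nonneg (abs_nonneg x) (inv_cosh_pos x).le
    have h6 := inv_cosh_pos x
    refine (abs_sub _ _).trans ?_
    linarith

lemma hasDerivAt_inv_cosh_pow (n : ℕ) (x : ℝ) :
    HasDerivAt (fun x => (Real.cosh x)⁻¹ ^ (n + 1))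
      (-((n + 1) * Real.sinh x * (Real.cosh x)⁻¹ ^ (n + 2))) x := by
  refine ((hasDerivAt_inv_cosh x).fun_pow (n + 1)).congr_deriv ?_
  push_cast
  ring

/-- Two integrations by parts against `cos`, using
`(sechᵐ)'' = m² sechᵐ - m (m + 1) sechᵐ⁺²` with `m = n + 1`. -/
lemma integral_cos_mul_inv_cosh_pow_add_two (n : ℕ) :
    (n + 1) * (n + 2) * ∫ x : ℝ, Real.cos x * (Real.cosh x)⁻¹ ^ (n + 3) =
      ((n + 1) ^ 2 + 1) * ∫ x : ℝ, Real.cos x * (Real.cosh x)⁻¹ ^ (n + 1) := by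
  have hint := (integrable_cos_mul_inv_cosh_pow (n + 2).add_one_ne_zero).const_mul (((n : ℝ) + 1) * (n + 2))
  have hint' := (integrable_cos_mul_inv_cosh_pow n.add_one_ne_zero).const_mul (((n : ℝ) + 1) ^ 2 + 1)
  rw [← sub_eq_zero, ← integral_const_mul, ← integral_const_mul, ← integral_sub hint hint']
  refine integral_eq_zero_of_hasDerivAt_of_abs_le (C := (n + 2) * 24) (F := fun x =>
    Real.cos x * ((n + 1) * Real.sinh x * (Real.cosh x)⁻¹ ^ (n + 2))
      - Real.sin x * (Real.cosh x)⁻¹ ^ (n + 1)) (fun x => ?_) (hint.sub hint') fun x => ?_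
  · have hc : Real.cosh x * (Real.cosh x)⁻¹ = 1 := mul_inv_cancel₀ (Real.cosh_pos x).ne'
    have h := ((Real.hasDerivAt_cos x).fun_mul (((Real.hasDerivAt_sinh x).const_mul ((n : ℝ) + 1)).fun_mul
      (hasDerivAt_inv_cosh_pow (n + 1) x))).fun_sub
      ((Real.hasDerivAt_sin x).fun_mul (hasDerivAt_inv_cosh_pow n x))
    refine h.congr_deriv ?_
    push_cast
    have hsq := Real.cosh_sq x
    generalize Real.cosh x = c at *
    generalize c⁻¹ = s at *
    linear_combination Real.cos x * (n + 1) * s ^ (n + 1) * hc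
      - Real.cos x * (n + 1) * (n + 2) * s ^ (n + 1) * ((c * s + 1) * hc - s ^ 2 * hsq)
  · have hs := inv_cosh_pos x
    have h1 : |Real.cos x * ((n + 1) * Real.sinh x * (Real.cosh x)⁻¹ ^ (n + 2))|
        ≤ (n + 1) * (Real.cosh x)⁻¹ := by
      rw [show Real.cos x * ((n + 1) * Real.sinh x * (Real.cosh x)⁻¹ ^ (n + 2)) =
        (Real.cos x * (Real.cosh x)⁻¹ ^ n) * (Real.sinh x * (Real.cosh x)⁻¹) *
          ((n + 1) * (Real.cosh x)⁻¹) by ring, abs_mul, abs_mul,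
        abs_of_pos (show 0 < (n + 1) * (Real.cosh x)⁻¹ by positivity)]
      exact mul_le_of_le_one_left (by positivity) (mul_le_one₀ (abs_cos_mul_inv_cosh_pow_le n x)
        (abs_nonneg _) (abs_sinh_mul_inv_cosh_le x))
    have h2 : |Real.sin x * (Real.cosh x)⁻¹ ^ (n + 1)| ≤ (Real.cosh x)⁻¹ := by
      rw [pow_succ, ← mul_assoc, abs_mul, abs_mul, abs_pow, abs_of_pos hs]
      exact mul_le_of_le_one_left hs.le (mul_le_one₀ (Real.abs_sin_le_one x)
        (by positivity) (pow_le_one₀ hs.le (inv_cosh_le_one x)))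
    have h3 := mul_le_mul_of_nonneg_left (inv_cosh_le x) (show (0 : ℝ) ≤ n + 2 by positivity)
    refine (abs_sub _ _).trans ?_
    linarith

lemma integral_cos_mul_inv_cosh_pow_three_pos : 0 < ∫ x : ℝ, Real.cos x * (Real.cosh x)⁻¹ ^ 3 := by
  have hs := integrable_inv_cosh_pow one_ne_zero
  have hs3 := integrable_inv_cosh_pow three_ne_zero
  have hd : Integrable fun x : ℝ => 2 * (Real.cosh x)⁻¹ ^ 3 - (Real.cosh x)⁻¹ ^ 1 :=
    (hs3.const_mul 2).sub hs
  have hzero : ∫ x : ℝ, (2 * (Real.cosh x)⁻¹ ^ 3 - (Real.cosh x)⁻¹ ^ 1) = 0 := by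
    refine integral_eq_zero_of_hasDerivAt_of_abs_le (C := 24)
      (F := fun x => Real.sinh x * (Real.cosh x)⁻¹ ^ 2) (fun x => ?_)
      hd fun x => ?_
    · have hc := (Real.cosh_pos x).ne'
      refine ((Real.hasDerivAt_sinh x).fun_mul (hasDerivAt_inv_cosh_pow 1 x)).congr_deriv ?_
      push_cast
      field_simp
      linear_combination 2 * Real.cosh_sq x
    · rw [pow_two, ← mul_assoc, abs_mul, abs_of_pos (inv_cosh_pos x)]
      have h1 := mul_le_mul_of_nonneg_right (abs_sinh_mul_inv_cosh_le x) (inv_cosh_pos x).le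
      linarith [inv_cosh_le x]
  have hpos : 0 < ∫ x : ℝ, (Real.cosh x)⁻¹ ^ 1 := by
    rw [integral_pos_iff_support_of_nonneg (fun x => (pow_pos (inv_cosh_pos x) 1).le) hs]
    rw [Function.support_eq_univ fun x => (pow_pos (inv_cosh_pos x) 1).ne']
    simp
  have hmono : ∫ x : ℝ, ((3 / 4) * (2 * (Real.cosh x)⁻¹ ^ 3 - (Real.cosh x)⁻¹ ^ 1)
      + (1 / 4) * (Real.cosh x)⁻¹ ^ 1) ≤ ∫ x : ℝ, Real.cos x * (Real.cosh x)⁻¹ ^ 3 := by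
    refine integral_mono ((hd.const_mul _).fun_add (hs.const_mul _))
      (integrable_cos_mul_inv_cosh_pow three_ne_zero) fun x => ?_
    have hc := Real.cosh_pos x
    have hcos : (3 - Real.cosh x ^ 2) / 2 ≤ Real.cos x := by
      have h1 : x ^ 2 ≤ Real.sinh x ^ 2 := by
        rw [sq_le_sq, Real.abs_sinh]
        exact Real.self_le_sinh_iff.2 (abs_nonneg x)
      linarith [Real.one_sub_sq_div_two_le_cos (x := x), Real.cosh_sq x]
    calc _ = (3 - Real.cosh x ^ 2) / 2 * (Real.cosh x)⁻¹ ^ 3 := by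
          field_simp
          ring
      _ ≤ _ := mul_le_mul_of_nonneg_right hcos (pow_pos (inv_cosh_pos x) 3).le
  rw [integral_add (hd.const_mul _) (hs.const_mul _),
    integral_const_mul, integral_const_mul, hzero] at hmono
  linarith

/-- with
`g(x) = −11(x tanh x − log(eˣ+e⁻ˣ)) cosh x + sech x + 21 sech³x − 20 sech⁵x`,
the function `x ↦ cos(x) g(x)` is integrable on `ℝ` and `∫ cos(x) g(x) dx > 0`. -/
theorem stmt_19 (g : ℝ → ℝ)
    (hg : g = fun x : ℝ =>
      -11 * (x * Real.tanh x - Real.log (Real.exp x + Real.exp (-x))) * Real.cosh x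
        + (Real.cosh x)⁻¹ + 21 * ((Real.cosh x)⁻¹) ^ 3 - 20 * ((Real.cosh x)⁻¹) ^ 5) :
    Integrable (fun x : ℝ => Real.cos x * g x) (volume : Measure ℝ) ∧
      0 < ∫ x : ℝ, Real.cos x * g x := by
  have heq : (fun x : ℝ => Real.cos x * g x) = fun x =>
      11 * (Real.cos x * (logTwoCoshDefect x * Real.cosh x))
        + Real.cos x * (Real.cosh x)⁻¹ ^ 1 + 21 * (Real.cos x * (Real.cosh x)⁻¹ ^ 3)
        - 20 * (Real.cos x * (Real.cosh x)⁻¹ ^ 5) := by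
    funext x
    simp only [hg, logTwoCoshDefect]
    ring
  have i0 := integrable_cos_mul_cosh_mul_logTwoCoshDefect.const_mul 11
  have i1 := integrable_cos_mul_inv_cosh_pow one_ne_zero
  have i3 := (integrable_cos_mul_inv_cosh_pow three_ne_zero).const_mul 21
  have i5 := (integrable_cos_mul_inv_cosh_pow (by decide : 5 ≠ 0)).const_mul 20
  have r3 := integral_cos_mul_inv_cosh_pow_add_two 0
  have r5 := integral_cos_mul_inv_cosh_pow_add_two 2
  norm_num only at r3 r5
  rw [heq]
  refine ⟨((i0.fun_add i1).fun_add i3).sub i5, ?_⟩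
  rw [integral_sub ((i0.fun_add i1).fun_add i3) i5, integral_add (i0.fun_add i1) i3, integral_add i0 i1,
    integral_const_mul, integral_const_mul, integral_const_mul,
    integral_cos_mul_cosh_mul_logTwoCoshDefect]
  linarith [integral_cos_mul_inv_cosh_pow_three_pos]
end
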